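/- arXiv:1903.10252 — 2 statements merged into one kernel-verified Lean document; each statement's English description precedes it below -/
import Mathlib

section
/- (Lemma 1, mainlobe locus of rotated angular beamforming) Let L be a natural number with L ≥ 2, let f_c, d, c be positive real numbers, and let Δf be a nonzero real number. For real numbers u and r (the coordinates cos θ − cos θ_T and R − R_T relative to the target point), set x(u,r) = π·(f_c·d·u − Δf·r)/c and define the normalized array factor B(u,r) = (1/L)·∑_{l=0}^{L−1} exp(i·(L−1−2l)·x(u,r)). If |x(u,r)| < π, then B(u,r) = 1 if and only if r = (f_c·d/Δf)·u. In particular, under this hypothesis the mainlobe of the beampattern (the set of points where the array factor equals its maximum value 1) is contained in the line through the target point with slope f_c·d/Δf in the (cos θ)–R plane, i.e., the line making angle arctan(f_c·d/Δf) with the cos θ-axis. -/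
open Complex Finset Real

theorem cos_eq_one_of_mean_exp_eq_one {ι : Type*} {s : Finset ι} (hs : s.Nonempty) {a : ι → ℝ}
    (h : (1 / (s.card : ℂ)) * ∑ j ∈ s, Complex.exp (Complex.I * (a j : ℂ)) = 1)
    {j : ι} (hj : j ∈ s) : Real.cos (a j) = 1 := by
  have hcard : (s.card : ℂ) ≠ 0 := by exact_mod_cast hs.card_pos.ne'
  have hsum : ∑ j ∈ s, Complex.exp (Complex.I * (a j : ℂ)) = (s.card : ℂ) := by
    field_simp at h
    exact h
  have hre : ∑ j ∈ s, Real.cos (a j) = ∑ _j ∈ s, (1 : ℝ) := by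
    have := congrArg Complex.re hsum
    simpa [Complex.re_sum, mul_comm Complex.I, Complex.exp_ofReal_mul_I_re] using this
  exact (Finset.sum_eq_sum_iff_of_le fun i _ => Real.cos_le_one (a i)).1 hre j hj

theorem eq_zero_of_cos_eq_one_of_cos_sub_two_mul_eq_one {y x : ℝ} (hy : Real.cos y = 1)
    (hyx : Real.cos (y - 2 * x) = 1) (hx : |x| < Real.pi) : x = 0 := by
  obtain ⟨m, hm⟩ := (Real.cos_eq_one_iff _).1 hy
  obtain ⟨k, hk⟩ := (Real.cos_eq_one_iff _).1 hyx
  have h2x : Real.cos (2 * x) = 1 :=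
    (Real.cos_eq_one_iff _).2 ⟨m - k, by push_cast; linarith⟩
  obtain ⟨hx₁, hx₂⟩ := abs_lt.1 hx
  have := (Real.cos_eq_one_iff_of_lt_of_lt (by linarith) (by linarith)).1 h2x
  linarith

theorem mean_exp_eq_one_iff {L : ℕ} (hL : 2 ≤ L) {x : ℝ} (hx : |x| < Real.pi) :
    (1 / (L : ℂ)) * ∑ l ∈ Finset.range L,
        Complex.exp (Complex.I * ((((L : ℝ) - 1 - 2 * (l : ℝ)) * x : ℝ) : ℂ)) = 1 ↔ x = 0 := by
  constructor
  · intro h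
    have hcos : ∀ l ∈ Finset.range L, Real.cos (((L : ℝ) - 1 - 2 * (l : ℝ)) * x) = 1 :=
      fun l hl => cos_eq_one_of_mean_exp_eq_one (a := fun l : ℕ => ((L : ℝ) - 1 - 2 * (l : ℝ)) * x)
        ⟨l, hl⟩ (by simpa only [Finset.card_range] using h) hl
    have h₀ := hcos 0 (Finset.mem_range.2 (by omega))
    have h₁ := hcos 1 (Finset.mem_range.2 (by omega))
    refine eq_zero_of_cos_eq_one_of_cos_sub_two_mul_eq_one h₀ ?_ hx
    convert h₁ using 2
    push_cast
    ring
  · rintro rfl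
    have : (L : ℂ) ≠ 0 := by exact_mod_cast (by omega : L ≠ 0)
    simp [this]

theorem RAB_mainlobe_locus (L : ℕ) (hL : 2 ≤ L) (fc d c Δf : ℝ)
    (hfc : 0 < fc) (hd : 0 < d) (hc : 0 < c) (hΔf : Δf ≠ 0) (u r : ℝ)
    (hx : |Real.pi * (fc * d * u - Δf * r) / c| < Real.pi) :
    (1 / (L : ℂ)) * ∑ l ∈ Finset.range L,
        Complex.exp (Complex.I *
          ((((L : ℝ) - 1 - 2 * (l : ℝ)) * (Real.pi * (fc * d * u - Δf * r) / c) : ℝ) : ℂ)) = 1 ↔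
      r = (fc * d / Δf) * u := by
  rw [mean_exp_eq_one_iff hL hx, div_eq_zero_iff, or_iff_left hc.ne', mul_eq_zero,
    or_iff_right Real.pi_ne_zero, sub_eq_zero, div_mul_eq_mul_div, eq_div_iff hΔf, mul_comm r,
    eq_comm]
end

section
/- (Lemma 3) Let M, N be natural numbers with M ≥ 1, N ≥ 1, and let Δf : {0,…,M−1} → ℝ satisfy the antisymmetry condition Δf_m = −Δf_{M−1−m} for all m (which for odd M forces Δf_{(M−1)/2} = 0). Define the FRB-resultant beampattern B(a,b) = (1/(MN))·∑_{m=0}^{M−1} ∑_{n=0}^{N−1} exp(i·((M−1−2m)·N·a + (N−1−2n)·(a − b·Δf_m))). Then for all real a, b: B(−a, b) = B(a, b), and B(a, −b) = conj(B(a, b)). That is, the FRB-resultant beampattern is symmetric with respect to the R-axis and conjugate symmetric with respect to the cos θ-axis. -/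
open Complex Finset Real

theorem Fin.cast_val_rev {R : Type*} [Ring R] {n : ℕ} (i : Fin n) :
    ((Fin.rev i : ℕ) : R) = (n : R) - 1 - ((i : ℕ) : R) := by
  rw [Fin.val_rev, Nat.cast_sub (Nat.succ_le_of_lt i.isLt)]
  push_cast
  abel

theorem Fin.sum_sum_rev {R : Type*} [AddCommMonoid R] {M N : ℕ} (f : Fin M → Fin N → R) :
    ∑ m, ∑ n, f (Fin.rev m) (Fin.rev n) = ∑ m, ∑ n, f m n := by
  rw [← Equiv.sum_comp Fin.revPerm fun m => ∑ n, f m n]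
  exact Finset.sum_congr rfl fun m _ => Equiv.sum_comp Fin.revPerm (f (Fin.rev m))

theorem FRB_beampattern_symmetry (M N : ℕ) (hM : 1 ≤ M) (hN : 1 ≤ N)
    (Δf : Fin M → ℝ) (hanti : ∀ m : Fin M, Δf m = -Δf (Fin.rev m)) (a b : ℝ) :
    (1 / ((M : ℂ) * (N : ℂ))) * ∑ m : Fin M, ∑ n : Fin N,
        Complex.exp (Complex.I *
          ((((M : ℝ) - 1 - 2 * ((m : ℕ) : ℝ)) * (N : ℝ) * (-a) +
              ((N : ℝ) - 1 - 2 * ((n : ℕ) : ℝ)) * (-a - b * Δf m) : ℝ) : ℂ)) =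
      (1 / ((M : ℂ) * (N : ℂ))) * ∑ m : Fin M, ∑ n : Fin N,
        Complex.exp (Complex.I *
          ((((M : ℝ) - 1 - 2 * ((m : ℕ) : ℝ)) * (N : ℝ) * a +
              ((N : ℝ) - 1 - 2 * ((n : ℕ) : ℝ)) * (a - b * Δf m) : ℝ) : ℂ)) ∧
    (1 / ((M : ℂ) * (N : ℂ))) * ∑ m : Fin M, ∑ n : Fin N,
        Complex.exp (Complex.I *
          ((((M : ℝ) - 1 - 2 * ((m : ℕ) : ℝ)) * (N : ℝ) * a +
              ((N : ℝ) - 1 - 2 * ((n : ℕ) : ℝ)) * (a - (-b) * Δf m) : ℝ) : ℂ)) =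
      starRingEnd ℂ
        ((1 / ((M : ℂ) * (N : ℂ))) * ∑ m : Fin M, ∑ n : Fin N,
          Complex.exp (Complex.I *
            ((((M : ℝ) - 1 - 2 * ((m : ℕ) : ℝ)) * (N : ℝ) * a +
                ((N : ℝ) - 1 - 2 * ((n : ℕ) : ℝ)) * (a - b * Δf m) : ℝ) : ℂ))) := by
  have hrev (m : Fin M) : Δf (Fin.rev m) = -Δf m := by rw [hanti m, neg_neg]
  constructor
  · congr 1
    rw [← Fin.sum_sum_rev]
    refine Finset.sum_congr rfl fun m _ => Finset.sum_congr rfl fun n _ => ?_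
    rw [hrev, Fin.cast_val_rev, Fin.cast_val_rev]
    congr 3
    ring
  · simp only [map_mul, map_div₀, map_one, map_natCast, map_sum, ← Complex.exp_conj,
      Complex.conj_I, Complex.conj_ofReal]
    congr 1
    rw [← Fin.sum_sum_rev]
    refine Finset.sum_congr rfl fun m _ => Finset.sum_congr rfl fun n _ => ?_
    rw [hrev, Fin.cast_val_rev, Fin.cast_val_rev, neg_mul Complex.I,
      ← mul_neg Complex.I, ← Complex.ofReal_neg]
    congr 3
    ring
end
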